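/- Let d > 1 and v ≥ 24d be integers. Every simple graph G on v vertices with at least (2d-1)·v - 2d² + d edges contains d pairwise vertex-disjoint cycles, or contains a clique of size 2d-1 (a set of 2d-1 vertices that are pairwise adjacent). -/

import Mathlib

namespace SimpleGraph

variable {V : Type*}

/-- `G` has a cycle all of whose vertices lie in `T`. -/
def HasCycleIn (G : SimpleGraph V) (T : Finset V) : Prop :=
  ∃ (v : V) (w : G.Walk v v), w.IsCycle ∧ ∀ x ∈ w.support, x ∈ T

lemma exists_square_or_triangle_of_length_le_four {G : SimpleGraph V} {v : V} {w : G.Walk v v}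
    (hw : w.IsCycle) (hl : w.length ≤ 4) :
    (∃ a ∈ w.support, ∃ b ∈ w.support, ∃ c ∈ w.support, G.Adj a b ∧ G.Adj b c ∧ G.Adj c a) ∨
    ∃ a ∈ w.support, ∃ b ∈ w.support, ∃ c ∈ w.support, ∃ d ∈ w.support,
      a ≠ c ∧ b ≠ d ∧ G.Adj a b ∧ G.Adj b c ∧ G.Adj c d ∧ G.Adj d a := by
  have h3 := hw.three_le_length
  match w, hw, hl, h3 with
  | .cons (v := b) h1 (.cons (v := c) h2 (.cons h3 .nil)), _, _, _ =>
    exact Or.inl ⟨v, by simp, b, by simp, c, by simp, h1, h2, h3⟩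
  | .cons (v := b) h1 (.cons (v := c) h2 (.cons (v := d) h3 (.cons h4 .nil))), hw, _, _ =>
    refine Or.inr ⟨v, by simp, b, by simp, c, by simp, d, by simp, ?_, ?_, h1, h2, h3, h4⟩
    · have := hw.support_nodup
      simp at this
      grind
    · have := hw.support_nodup
      simp at this
      grind
  | .cons _ (.cons _ (.cons _ (.cons _ (.cons _ p)))), _, hl, _ => simp at hl; omega
  | .cons _ (.cons _ .nil), _, _, h3 => simp at h3
  | .cons _ .nil, _, _, h3 => simp at h3
  | .nil, _, _, h3 => simp at h3

/-- A path between two neighbours of a vertex outside it closes up to a cycle. -/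
lemma Walk.IsPath.isCycle_of_adj {G : SimpleGraph V} {a b x : V} {p : G.Walk a b} (hp : p.IsPath)
    (hx : x ∉ p.support) (hab : a ≠ b) (ha : G.Adj x a) (hb : G.Adj b x) :
    (Walk.cons ha (p.concat hb)).IsCycle := by
  rw [Walk.cons_isCycle_iff]
  refine ⟨hp.concat hx hb, ?_⟩
  rw [Walk.edges_concat, List.concat_eq_append, List.mem_append, not_or]
  refine ⟨fun h => hx (p.fst_mem_support_of_mem_edges h), ?_⟩
  simp [hab]
  grind

section Degrees

variable (G : SimpleGraph V) [DecidableRel G.Adj]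

/-- The neighbours of `v` in `A`. -/
def nbrsIn (A : Finset V) (v : V) : Finset V := {u ∈ A | G.Adj v u}

variable {G}

@[simp] lemma mem_nbrsIn {A : Finset V} {v u : V} : u ∈ G.nbrsIn A v ↔ u ∈ A ∧ G.Adj v u := by
  simp [nbrsIn]

lemma nbrsIn_subset {A : Finset V} {v : V} : G.nbrsIn A v ⊆ A := Finset.filter_subset _ _

variable (G)

/-- The number of neighbours of `v` in `A`. -/
def degIn (A : Finset V) (v : V) : ℕ := (G.nbrsIn A v).card

/-- The sum of the degrees in the subgraph induced on `A`. -/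
def degSum (A : Finset V) : ℕ := ∑ v ∈ A, G.degIn A v

variable {G}

lemma degIn_le_card {A : Finset V} (v : V) : G.degIn A v ≤ A.card :=
  Finset.card_filter_le _ _

lemma degIn_lt_card {A : Finset V} {v : V} (hv : v ∈ A) : G.degIn A v < A.card := by
  refine Finset.card_lt_card (Finset.ssubset_iff_subset_ne.2 ⟨nbrsIn_subset, fun h => ?_⟩)
  rw [← h] at hv
  simp at hv

lemma sum_degIn_comm (A B : Finset V) : ∑ v ∈ A, G.degIn B v = ∑ v ∈ B, G.degIn A v := by
  have := Finset.sum_card_bipartiteAbove_eq_sum_card_bipartiteBelow G.Adj (s := A) (t := B)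
  simp only [Finset.bipartiteAbove, Finset.bipartiteBelow, G.adj_comm _] at this
  convert this using 3 <;> rfl

lemma degSum_eq_zero_of_forall_not_adj {F : Finset V}
    (h : ∀ u ∈ F, ∀ v ∈ F, ¬ G.Adj u v) : G.degSum F = 0 := by
  refine Finset.sum_eq_zero fun u hu => Finset.card_eq_zero.2 ?_
  refine Finset.eq_empty_of_forall_notMem fun v hv => ?_
  rw [mem_nbrsIn] at hv
  exact h u hu v hv.1 hv.2

lemma degSum_univ [Fintype V] : G.degSum Finset.univ = 2 * G.edgeFinset.card := by
  rw [← sum_degrees_eq_twice_card_edges]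
  refine Finset.sum_congr rfl fun v _ => ?_
  rw [degIn, ← card_neighborFinset_eq_degree]
  congr 1
  ext; simp

end Degrees

variable [DecidableEq V]

/-- `A` contains `k` pairwise vertex-disjoint cycles of `G`. -/
def HasDisjointCycles (G : SimpleGraph V) : ℕ → Finset V → Prop
  | 0, _ => True
  | k + 1, A => ∃ T ⊆ A, G.HasCycleIn T ∧ HasDisjointCycles G k (A \ T)

lemma HasDisjointCycles.mono {G : SimpleGraph V} {k : ℕ} {A B : Finset V}
    (h : G.HasDisjointCycles k A) (hAB : A ⊆ B) : G.HasDisjointCycles k B := by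
  induction k generalizing A B with
  | zero => trivial
  | succ k ih =>
    obtain ⟨T, hT, hc, h⟩ := h
    exact ⟨T, hT.trans hAB, hc, ih h (Finset.sdiff_subset_sdiff hAB le_rfl)⟩

lemma HasDisjointCycles.exists_walks {G : SimpleGraph V} {k : ℕ} {A : Finset V}
    (h : G.HasDisjointCycles k A) :
    ∃ (c : Fin k → V) (w : ∀ i : Fin k, G.Walk (c i) (c i)),
      (∀ i, (w i).IsCycle) ∧ (∀ i, ∀ x ∈ (w i).support, x ∈ A) ∧
      ∀ i j, i ≠ j → ∀ x, x ∈ (w i).support → x ∉ (w j).support := by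
  induction k generalizing A with
  | zero => exact ⟨fun i => i.elim0, fun i => i.elim0, fun i => i.elim0, fun i => i.elim0,
      fun i => i.elim0⟩
  | succ k ih =>
    obtain ⟨T, hT, ⟨v, u, hu, hs⟩, h⟩ := h
    obtain ⟨c, w, h1, h2, h3⟩ := ih h
    refine ⟨Fin.cons v c, Fin.cons (α := fun i : Fin (k + 1) =>
      G.Walk ((Fin.cons v c : Fin (k + 1) → V) i) ((Fin.cons v c : Fin (k + 1) → V) i)) u w,
      ?_, ?_, ?_⟩
    · intro i
      cases i using Fin.cases with
      | zero => exact hu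
      | succ i => exact h1 i
    · intro i
      cases i using Fin.cases with
      | zero => exact fun x hx => hT (hs x hx)
      | succ i => exact fun x hx => (Finset.mem_sdiff.1 (h2 i x hx)).1
    · intro i j hij x hx hx'
      cases i using Fin.cases with
      | zero =>
        cases j using Fin.cases with
        | zero => exact hij rfl
        | succ j => exact (Finset.mem_sdiff.1 (h2 j x hx')).2 (hs x hx)
      | succ i =>
        cases j using Fin.cases with
        | zero => exact (Finset.mem_sdiff.1 (h2 i x hx)).2 (hs x hx')
        | succ j => exact h3 i j (fun h => hij (congrArg _ h)) x hx hx'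

lemma hasCycleIn_triangle {G : SimpleGraph V} {a b c : V} (hab : G.Adj a b) (hbc : G.Adj b c)
    (hca : G.Adj c a) : G.HasCycleIn {a, b, c} := by
  refine ⟨a, .cons hab (.cons hbc (.cons hca .nil)), ?_, ?_⟩
  · have := hab.ne; have := hbc.ne; have := hca.ne
    simp [Walk.cons_isCycle_iff, Walk.cons_isPath_iff]
    grind
  · simp

lemma hasCycleIn_square {G : SimpleGraph V} {a b c d : V} (hab : G.Adj a b) (hbc : G.Adj b c)
    (hcd : G.Adj c d) (hda : G.Adj d a) (hac : a ≠ c) (hbd : b ≠ d) :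
    G.HasCycleIn {a, b, c, d} := by
  refine ⟨a, .cons hab (.cons hbc (.cons hcd (.cons hda .nil))), ?_, ?_⟩
  · have := hab.ne; have := hbc.ne; have := hcd.ne; have := hda.ne
    simp [Walk.cons_isCycle_iff, Walk.cons_isPath_iff]
    grind
  · simp

variable {G : SimpleGraph V}

lemma Walk.IsCycle.length_le_card {v : V} {w : G.Walk v v} (hw : w.IsCycle) {T : Finset V}
    (hT : ∀ x ∈ w.support, x ∈ T) : w.length ≤ T.card := by
  have h1 : w.support.tail.toFinset.card = w.length := by
    rw [List.toFinset_card_of_nodup hw.support_nodup]; simp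
  rw [← h1]
  refine Finset.card_le_card fun x hx => hT x (List.mem_of_mem_tail (List.mem_toFinset.1 hx))

lemma Walk.IsCycle.card_support_toFinset {v : V} {w : G.Walk v v} (hw : w.IsCycle) :
    w.support.toFinset.card = w.length := by
  apply le_antisymm _ (hw.length_le_card (by simp))
  have h1 : w.support.tail.toFinset.card = w.length := by
    rw [List.toFinset_card_of_nodup hw.support_nodup]; simp
  rw [← h1]
  refine Finset.card_le_card fun x hx => ?_
  rw [List.mem_toFinset] at hx ⊢
  rcases (Walk.mem_support_iff _).1 hx with rfl | h
  · exact w.end_mem_tail_support hw.not_nil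
  · exact h

variable [DecidableRel G.Adj]

lemma degIn_sdiff {A C : Finset V} (h : C ⊆ A) (v : V) :
    G.degIn A v = G.degIn C v + G.degIn (A \ C) v := by
  unfold degIn nbrsIn
  rw [← Finset.card_union_of_disjoint, ← Finset.filter_union, Finset.union_sdiff_of_subset h]
  exact Finset.disjoint_filter_filter Finset.disjoint_sdiff

lemma degSum_sdiff {A C : Finset V} (h : C ⊆ A) :
    G.degSum A + G.degSum C = G.degSum (A \ C) + 2 * ∑ c ∈ C, G.degIn A c := by
  have h1 : G.degSum A = ∑ v ∈ A \ C, G.degIn A v + ∑ v ∈ C, G.degIn A v :=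
    (Finset.sum_sdiff h).symm
  have h2 : ∑ v ∈ A \ C, G.degIn A v = ∑ v ∈ A \ C, G.degIn C v + G.degSum (A \ C) := by
    rw [degSum, ← Finset.sum_add_distrib]
    exact Finset.sum_congr rfl fun v _ => degIn_sdiff h v
  have h3 : ∑ v ∈ C, G.degIn A v = G.degSum C + ∑ v ∈ C, G.degIn (A \ C) v := by
    rw [degSum, ← Finset.sum_add_distrib]
    exact Finset.sum_congr rfl fun v _ => degIn_sdiff h v
  have h4 := sum_degIn_comm (G := G) C (A \ C)
  omega

lemma degSum_erase {A : Finset V} {v : V} (h : v ∈ A) :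
    G.degSum A = G.degSum (A.erase v) + 2 * G.degIn A v := by
  have := degSum_sdiff (G := G) (Finset.singleton_subset_iff.2 h)
  have h0 : G.degSum {v} = 0 := by simp [degSum, degIn, nbrsIn, Finset.filter_singleton]
  rw [h0, Finset.sum_singleton, Finset.sdiff_singleton_eq_erase] at this
  exact this

lemma hasCycleIn_of_two_le_degIn {Y : Finset V} (hY : Y.Nonempty)
    (hdeg : ∀ v ∈ Y, 2 ≤ G.degIn Y v) : G.HasCycleIn Y := by
  by_contra hno
  have hac : (G.induce (Y : Set V)).IsAcyclic := by
    intro v w hw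
    refine hno ⟨_, w.map (Embedding.induce (Y : Set V)).toHom,
      hw.map (Embedding.induce (G := G) (Y : Set V)).injective, ?_⟩
    intro x hx
    rw [Walk.support_map, List.mem_map] at hx
    obtain ⟨y, -, rfl⟩ := hx
    exact y.2
  have hlong : ∀ n : ℕ, ∃ (u v : (Y : Set V)) (p : (G.induce (Y : Set V)).Walk u v),
      p.IsPath ∧ p.length = n := by
    intro n
    induction n with
    | zero =>
      obtain ⟨v, hv⟩ := hY
      exact ⟨⟨v, hv⟩, ⟨v, hv⟩, .nil, by simp, by simp⟩
    | succ n ih =>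
      obtain ⟨u, v, p, hp, hn⟩ := ih
      obtain ⟨a, ha, b, hb, hab⟩ := Finset.one_lt_card.1 (hdeg v v.2)
      rw [mem_nbrsIn] at ha hb
      have key : ∀ c : (Y : Set V), G.Adj v c → c ∉ p.support →
          ∃ (u v : (Y : Set V)) (p : (G.induce (Y : Set V)).Walk u v),
            p.IsPath ∧ p.length = n + 1 := by
        intro c hc hcs
        have hadj : (G.induce (Y : Set V)).Adj v c := hc
        exact ⟨u, c, p.concat hadj, hp.concat hcs hadj, by simp [hn]⟩
      by_cases h1 : (⟨a, ha.1⟩ : (Y : Set V)) ∈ p.support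
      · by_cases h2 : (⟨b, hb.1⟩ : (Y : Set V)) ∈ p.support
        · have e1 := hac.eq_penultimate_of_adj_end hp (w := ⟨a, ha.1⟩) ha.2 h1
          have e2 := hac.eq_penultimate_of_adj_end hp (w := ⟨b, hb.1⟩) hb.2 h2
          exact absurd (congrArg Subtype.val (e1.trans e2.symm)) hab
        · exact key _ hb.2 h2
      · exact key _ ha.2 h1
  obtain ⟨u, v, p, hp, hn⟩ := hlong (Fintype.card (Y : Set V))
  exact absurd hp.length_lt (by omega)

/-- In a set without cycles of length at most four, a shortest cycle can be removed
decreasing no other degree by more than one. -/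
lemma exists_cycle_degIn_sdiff {Y : Finset V} (hY : Y.Nonempty)
    (hdeg : ∀ v ∈ Y, 2 ≤ G.degIn Y v)
    (h3 : ∀ a ∈ Y, ∀ b ∈ Y, ∀ c ∈ Y, G.Adj a b → G.Adj b c → ¬ G.Adj c a)
    (h4 : ∀ a ∈ Y, ∀ b ∈ Y, ∀ c ∈ Y, ∀ d ∈ Y, a ≠ c → b ≠ d →
      G.Adj a b → G.Adj b c → G.Adj c d → ¬ G.Adj d a) :
    ∃ T ⊆ Y, G.HasCycleIn T ∧ (∀ v ∈ Y \ T, G.degIn T v ≤ 1) ∧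
      ∀ a ∈ T, ¬ G.HasCycleIn (T.erase a) := by
  have hex : ∃ n : ℕ, ∃ (v : V) (w : G.Walk v v), w.IsCycle ∧ (∀ x ∈ w.support, x ∈ Y) ∧
      w.length = n := by
    obtain ⟨v, w, hw, hs⟩ := hasCycleIn_of_two_le_degIn hY hdeg
    exact ⟨_, v, w, hw, hs, rfl⟩
  classical
  obtain ⟨v, w, hw, hs, hl⟩ := Nat.find_spec hex
  have hmin : ∀ (u : V) (q : G.Walk u u), q.IsCycle → (∀ x ∈ q.support, x ∈ Y) →
      w.length ≤ q.length := fun u q hq hqs => hl ▸ Nat.find_min' hex ⟨u, q, hq, hqs, rfl⟩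
  refine ⟨w.support.toFinset, fun x hx => hs x (List.mem_toFinset.1 hx),
    ⟨v, w, hw, by simp⟩, ?_, ?_⟩
  · intro x hx
    by_contra! hcon
    obtain ⟨a, ha, b, hb, hab⟩ := Finset.one_lt_card.1 hcon
    simp only [mem_nbrsIn, List.mem_toFinset, Finset.mem_sdiff] at ha hb hx
    have hbr : b ∈ (w.rotate a ha.1).support := by
      rw [Walk.mem_support_rotate_iff]; exact hb.1
    set c := w.rotate a ha.1 with hc
    have hcc : c.IsCycle := hw.rotate ha.1
    have hlen : (c.takeUntil b hbr).length + (c.dropUntil b hbr).length = w.length := by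
      rw [← Walk.length_append, Walk.take_spec, hc, Walk.length_rotate]
    have hp1 : (c.takeUntil b hbr).IsPath := hcc.isPath_takeUntil hbr
    have hp2 : (c.dropUntil b hbr).IsPath := by
      have := hcc
      rw [← Walk.take_spec c hbr] at this
      exact this.isPath_of_append_right (Walk.not_nil_of_ne hab)
    have hsub : ∀ y ∈ c.support, y ∈ w.support := fun y hy => by
      rwa [hc, Walk.mem_support_rotate_iff] at hy
    have hs1 : ∀ y ∈ (c.takeUntil b hbr).support, y ∈ w.support := fun y hy =>
      hsub y (Walk.support_takeUntil_subset_support _ _ hy)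
    have hs2 : ∀ y ∈ (c.dropUntil b hbr).support, y ∈ w.support := fun y hy =>
      hsub y (Walk.support_dropUntil_subset_support _ _ hy)
    have l1 := hmin _ _ (hp1.isCycle_of_adj (fun h => hx.2 (hs1 x h)) hab ha.2 hb.2.symm) (by
      intro y hy
      simp [Walk.support_concat] at hy
      grind)
    have l2 := hmin _ _ (hp2.isCycle_of_adj (fun h => hx.2 (hs2 x h)) hab.symm hb.2 ha.2.symm) (by
      intro y hy
      simp [Walk.support_concat] at hy
      grind)
    simp only [Walk.length_cons, Walk.length_concat] at l1 l2
    rcases exists_square_or_triangle_of_length_le_four hw (by omega) with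
      ⟨a, ha, b, hb, c, hc, h⟩ | ⟨a, ha, b, hb, c, hc, d, hd, h1, h2, h⟩
    · exact h3 a (hs a ha) b (hs b hb) c (hs c hc) h.1 h.2.1 h.2.2
    · exact h4 a (hs a ha) b (hs b hb) c (hs c hc) d (hs d hd) h1 h2 h.1 h.2.1 h.2.2.1 h.2.2.2
  · rintro a ha ⟨u, q, hq, hqs⟩
    have l1 := hmin u q hq (fun x hx =>
      hs x (List.mem_toFinset.1 (Finset.mem_of_mem_erase (hqs x hx))))
    have l2 := hq.length_le_card hqs
    rw [Finset.card_erase_of_mem ha, hw.card_support_toFinset] at l2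
    have := hw.three_le_length
    omega

lemma hasDisjointCycles_of_lt_degIn {k : ℕ} {Y : Finset V} (hY : Y.Nonempty)
    (hdeg : ∀ v ∈ Y, k < G.degIn Y v)
    (h3 : ∀ a ∈ Y, ∀ b ∈ Y, ∀ c ∈ Y, G.Adj a b → G.Adj b c → ¬ G.Adj c a)
    (h4 : ∀ a ∈ Y, ∀ b ∈ Y, ∀ c ∈ Y, ∀ d ∈ Y, a ≠ c → b ≠ d →
      G.Adj a b → G.Adj b c → G.Adj c d → ¬ G.Adj d a) :
    G.HasDisjointCycles k Y := by
  induction k generalizing Y with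
  | zero => trivial
  | succ k ih =>
    obtain ⟨T, hT, hc, hd, he⟩ := exists_cycle_degIn_sdiff hY
      (fun v hv => by have := hdeg v hv; omega) h3 h4
    refine ⟨T, hT, hc, ?_⟩
    rcases Nat.eq_zero_or_pos k with rfl | hk
    · trivial
    refine ih ?_ ?_ ?_ ?_
    · rw [Finset.nonempty_iff_ne_empty, Ne, Finset.sdiff_eq_empty_iff_subset]
      intro hYT
      obtain rfl := Finset.Subset.antisymm hT hYT
      obtain ⟨a, ha⟩ := hY
      have hlow : ∀ v ∈ T, 2 ≤ G.degIn (T.erase a) v := by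
        intro v hv
        have h1 := degIn_sdiff (G := G) (Finset.singleton_subset_iff.2 ha) v
        rw [Finset.sdiff_singleton_eq_erase] at h1
        have h2 := degIn_le_card (G := G) (A := {a}) v
        rw [Finset.card_singleton] at h2
        have := hdeg v hv
        omega
      refine he a ha (hasCycleIn_of_two_le_degIn ?_ fun v hv => hlow v (Finset.mem_of_mem_erase hv))
      have h2 : 0 < G.degIn (T.erase a) a := by have := hlow a ha; omega
      exact (Finset.card_pos.1 h2).mono nbrsIn_subset
    · intro v hv
      have h1 := degIn_sdiff (G := G) hT v
      have h2 := hd v hv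
      have h3 := hdeg v (Finset.mem_sdiff.1 hv).1
      omega
    · intro a ha b hb c hc
      simp only [Finset.mem_sdiff] at ha hb hc
      exact h3 a ha.1 b hb.1 c hc.1
    · intro a ha b hb c hc d hd
      simp only [Finset.mem_sdiff] at ha hb hc hd
      exact h4 a ha.1 b hb.1 c hc.1 d hd.1

/-- **Mantel's theorem**, in terms of degree sums. -/
lemma two_mul_degSum_le_sq {F : Finset V}
    (h3 : ∀ a ∈ F, ∀ b ∈ F, ∀ c ∈ F, G.Adj a b → G.Adj b c → ¬ G.Adj c a) :
    2 * G.degSum F ≤ F.card ^ 2 := by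
  rcases F.eq_empty_or_nonempty with rfl | hF
  · simp [degSum]
  obtain ⟨v, hv, hmax⟩ := F.exists_max_image (G.degIn F) hF
  set N := G.nbrsIn F v with hN
  have hNF : N ⊆ F := nbrsIn_subset
  have hcard : (F \ N).card + N.card = F.card := Finset.card_sdiff_add_card_eq_card hNF
  have h0 : G.degSum N = 0 := by
    refine degSum_eq_zero_of_forall_not_adj fun a ha b hb hab => ?_
    rw [hN, mem_nbrsIn] at ha hb
    exact h3 v hv a ha.1 b hb.1 ha.2 hab hb.2.symm
  have h1 := degSum_sdiff (G := G) hNF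
  have h2 : G.degSum F = ∑ u ∈ F \ N, G.degIn F u + ∑ u ∈ N, G.degIn F u :=
    (Finset.sum_sdiff hNF).symm
  have h4 : ∑ u ∈ F \ N, G.degIn F u ≤ (F \ N).card * N.card := by
    rw [← smul_eq_mul]
    exact Finset.sum_le_card_nsmul _ _ _ fun u hu => hmax u (Finset.mem_sdiff.1 hu).1
  have h5 : G.degSum F ≤ 2 * ((F \ N).card * N.card) := by omega
  rw [← hcard]
  nlinarith [sq_nonneg (((F \ N).card : ℤ) - N.card), two_mul_le_add_sq ((F \ N).card) N.card]

lemma hasDisjointCycles_of_degSum {k : ℕ} {F : Finset V}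
    (h3 : ∀ a ∈ F, ∀ b ∈ F, ∀ c ∈ F, G.Adj a b → G.Adj b c → ¬ G.Adj c a)
    (h4 : ∀ a ∈ F, ∀ b ∈ F, ∀ c ∈ F, ∀ d ∈ F, a ≠ c → b ≠ d →
      G.Adj a b → G.Adj b c → G.Adj c d → ¬ G.Adj d a)
    (hF : 2 * k ≤ F.card) (hE : 2 * k * F.card < G.degSum F + 2 * k ^ 2) :
    G.HasDisjointCycles k F := by
  induction hn : F.card generalizing F with
  | zero =>
    obtain rfl : k = 0 := by omega
    trivial
  | succ n ih =>
    by_cases hdeg : ∀ v ∈ F, k < G.degIn F v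
    · exact hasDisjointCycles_of_lt_degIn (Finset.card_pos.1 (by omega)) hdeg h3 h4
    push Not at hdeg
    obtain ⟨v, hv, hd⟩ := hdeg
    have hc := Finset.card_erase_of_mem hv
    rcases hF.eq_or_lt with heq | hlt
    · have := two_mul_degSum_le_sq h3
      rw [← heq] at this hE
      nlinarith
    · have he := degSum_erase (G := G) hv
      have hsub := F.erase_subset v
      refine (ih (F := F.erase v) (fun a ha b hb c hc => h3 a (hsub ha) b (hsub hb) c (hsub hc))
        (fun a ha b hb c hc d hd => h4 a (hsub ha) b (hsub hb) c (hsub hc) d (hsub hd))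
        (by omega) ?_ (by omega)).mono hsub
      rw [hc, hn]
      rw [hn] at hE
      simp only [Nat.add_sub_cancel]
      nlinarith

lemma degIn_add_two_le {A : Finset V} {x y : V} (hx : x ∈ A) (hy : y ∈ A) (hxy : x ≠ y)
    (h : ¬ G.Adj x y) : G.degIn A x + 2 ≤ A.card := by
  have h1 : G.nbrsIn A x ⊆ (A.erase x).erase y := by
    intro u hu
    rw [mem_nbrsIn] at hu
    rw [Finset.mem_erase, Finset.mem_erase]
    exact ⟨fun e => h (e ▸ hu.2), hu.2.ne', hu.1⟩
  have h2 := Finset.card_le_card h1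
  have h3 := Finset.card_erase_of_mem (Finset.mem_erase.2 ⟨hxy.symm, hy⟩)
  have h4 := Finset.card_erase_of_mem hx
  have h5 : 1 < A.card := Finset.one_lt_card.2 ⟨x, hx, y, hy, hxy⟩
  unfold degIn
  omega

lemma adj_of_card_le_degIn {A : Finset V} {x y : V} (hx : x ∈ A) (hy : y ∈ A) (hxy : x ≠ y)
    (h : A.card ≤ G.degIn A x + 1) : G.Adj x y := by
  by_contra hn
  have := degIn_add_two_le hx hy hxy hn
  omega

lemma degIn_add_degIn_le {F : Finset V} {u v : V}
    (h : ∀ w ∈ F, G.Adj u w → ¬ G.Adj v w) : G.degIn F u + G.degIn F v ≤ F.card := by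
  unfold degIn
  rw [← Finset.card_union_of_disjoint]
  · exact Finset.card_le_card (Finset.union_subset nbrsIn_subset nbrsIn_subset)
  · rw [Finset.disjoint_left]
    intro w hw hw'
    rw [mem_nbrsIn] at hw hw'
    exact h w hw.1 hw.2 hw'.2

/-- Vertices any two of which have many common neighbours in `U` can be paired up into
disjoint squares. -/
lemma hasDisjointCycles_of_common_nbrs {k : ℕ} {X U : Finset V} (hXU : Disjoint X U)
    (hX : 2 * k ≤ X.card)
    (hU : ∀ x ∈ X, ∀ y ∈ X, x ≠ y → 2 * k ≤ (G.nbrsIn U x ∩ G.nbrsIn U y).card) :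
    G.HasDisjointCycles k (X ∪ U) := by
  induction k generalizing X U with
  | zero => trivial
  | succ k ih =>
    obtain ⟨x, hx, y, hy, hxy⟩ := Finset.one_lt_card.1 (show 1 < X.card by omega)
    obtain ⟨u, hu, v, hv, huv⟩ := Finset.one_lt_card.1
      (show 1 < (G.nbrsIn U x ∩ G.nbrsIn U y).card by have := hU x hx y hy hxy; omega)
    simp only [Finset.mem_inter, mem_nbrsIn] at hu hv
    have hsub : (X \ {x, y}) ∪ (U \ {u, v}) ⊆ (X ∪ U) \ {x, u, y, v} := by
      intro z hz
      rw [Finset.disjoint_left] at hXU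
      simp only [Finset.mem_union, Finset.mem_sdiff, Finset.mem_insert,
        Finset.mem_singleton] at hz ⊢
      grind
    refine ⟨{x, u, y, v}, ?_, hasCycleIn_square hu.1.2 hu.2.2.symm hv.2.2 hv.1.2.symm hxy huv,
      (ih ?_ ?_ ?_).mono hsub⟩
    · intro z hz
      simp only [Finset.mem_insert, Finset.mem_singleton] at hz
      rw [Finset.mem_union]
      rcases hz with rfl | rfl | rfl | rfl
      · exact Or.inl hx
      · exact Or.inr hu.1.1
      · exact Or.inl hy
      · exact Or.inr hv.1.1
    · exact hXU.mono Finset.sdiff_subset Finset.sdiff_subset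
    · have h1 := Finset.le_card_sdiff {x, y} X
      have h2 := Finset.card_le_two (a := x) (b := y)
      omega
    · intro a ha b hb hab
      have h0 := hU a (Finset.mem_sdiff.1 ha).1 b (Finset.mem_sdiff.1 hb).1 hab
      have h1 := Finset.le_card_sdiff {u, v} (G.nbrsIn U a ∩ G.nbrsIn U b)
      have h2 := Finset.card_le_two (a := u) (b := v)
      have h3 : (G.nbrsIn U a ∩ G.nbrsIn U b) \ {u, v} ⊆
          G.nbrsIn (U \ {u, v}) a ∩ G.nbrsIn (U \ {u, v}) b := by
        intro z hz
        simp only [Finset.mem_sdiff, Finset.mem_inter, mem_nbrsIn] at hz ⊢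
        tauto
      have h4 := Finset.card_le_card h3
      omega

lemma hasDisjointCycles_of_large_degIn {j k : ℕ} {A X C : Finset V} (hk : 1 ≤ k)
    (hn : 24 * (k + 1) ≤ A.card) (hX : X ⊆ A) (hXC : Disjoint X C)
    (hXcard : X.card = 2 * j) (hj : j ≤ k + 1) (hC : C.card ≤ 6)
    (hdeg : ∀ x ∈ X, 2 * A.card + 2 * k ≤ 3 * G.degIn A x + 1) :
    G.HasDisjointCycles j (A \ C) := by
  refine (hasDisjointCycles_of_common_nbrs (X := X) (U := A \ (X ∪ C)) ?_ hXcard.ge ?_).mono ?_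
  · exact Finset.disjoint_sdiff.mono_left Finset.subset_union_left
  · intro x hx y hy _
    have h1 : G.nbrsIn A x ∩ G.nbrsIn A y ⊆
        (G.nbrsIn (A \ (X ∪ C)) x ∩ G.nbrsIn (A \ (X ∪ C)) y) ∪ (X ∪ C) := by
      intro z hz
      simp only [Finset.mem_sdiff, Finset.mem_inter, mem_nbrsIn, Finset.mem_union] at hz ⊢
      tauto
    have h2 := (Finset.card_le_card h1).trans (Finset.card_union_le _ _)
    have h3 := Finset.card_union_le X C
    have h4 := Finset.card_union_add_card_inter (G.nbrsIn A x) (G.nbrsIn A y)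
    have h5 : (G.nbrsIn A x ∪ G.nbrsIn A y).card ≤ A.card :=
      Finset.card_le_card (Finset.union_subset nbrsIn_subset nbrsIn_subset)
    have h6 := hdeg x hx
    have h7 := hdeg y hy
    unfold degIn at h6 h7
    omega
  · intro z hz
    rw [Finset.disjoint_left] at hXC
    simp only [Finset.mem_sdiff, Finset.mem_union] at hz ⊢
    rcases hz with hz | hz
    · exact ⟨hX hz, hXC hz⟩
    · tauto

/-- If `x` lies in no triangle and no square with the other vertices in `F`, then few common
neighbours of `x` and `y` have neighbours in `F`. -/
lemma le_card_isolated {F : Finset V} {x y : V}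
    (h3 : ∀ u ∈ F, ∀ v ∈ F, G.Adj x u → G.Adj x v → ¬ G.Adj u v)
    (h4 : ∀ u ∈ F, ∀ v ∈ F, ∀ w ∈ F, u ≠ w → G.Adj x u → G.Adj u v → G.Adj v w → ¬ G.Adj x w) :
    2 * G.degIn F x + G.degIn F y ≤
      2 * F.card + {u ∈ G.nbrsIn F x ∩ G.nbrsIn F y | G.degIn F u = 0}.card := by
  have h1 := Finset.card_union_add_card_inter (G.nbrsIn F x) (G.nbrsIn F y)
  have h2 : (G.nbrsIn F x ∪ G.nbrsIn F y).card ≤ F.card :=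
    Finset.card_le_card (Finset.union_subset nbrsIn_subset nbrsIn_subset)
  have h5 := Finset.card_filter_add_card_filter_not (s := G.nbrsIn F x ∩ G.nbrsIn F y)
    (fun u => G.degIn F u = 0)
  have h6 : (F \ G.nbrsIn F x).card + (G.nbrsIn F x).card = F.card :=
    Finset.card_sdiff_add_card_eq_card nbrsIn_subset
  have h7 : {u ∈ G.nbrsIn F x ∩ G.nbrsIn F y | ¬ G.degIn F u = 0}.card ≤
      (F \ G.nbrsIn F x).card := by
    have hex : ∀ u ∈ ({u ∈ G.nbrsIn F x ∩ G.nbrsIn F y | ¬ G.degIn F u = 0} : Finset V),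
        ∃ r ∈ F, G.Adj u r := by
      intro u hu
      rw [Finset.mem_filter] at hu
      obtain ⟨r, hr⟩ := Finset.card_pos.1 (Nat.pos_of_ne_zero hu.2)
      rw [mem_nbrsIn] at hr
      exact ⟨r, hr⟩
    choose! f hf using hex
    refine Finset.card_le_card_of_injOn f ?_ ?_
    · intro u hu
      have hu' := hf u hu
      simp only [Finset.coe_filter, Finset.mem_inter, mem_nbrsIn, Set.mem_ofPred_eq] at hu
      simp only [Finset.coe_sdiff, Set.mem_sdiff, Finset.mem_coe, mem_nbrsIn]
      exact ⟨hu'.1, fun h => h3 u hu.1.1.1 _ hu'.1 hu.1.1.2 h.2 hu'.2⟩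
    · intro u hu w hw huw
      have hu' := hf u hu
      have hw' := hf w hw
      simp only [Finset.coe_filter, Finset.mem_inter, mem_nbrsIn, Set.mem_ofPred_eq] at hu hw
      by_contra hne
      rw [← huw] at hw'
      exact h4 u hu.1.1.1 _ hu'.1 w hw.1.1.1 hne hu.1.1.2 hu'.2 hw'.2.symm hw.1.1.2
  unfold degIn at *
  omega

/-- Removing a short cycle from a set without `k + 1` disjoint cycles must destroy many edges. -/
lemma degSum_le_of_short_cycle {k : ℕ}
    (ih : ∀ B : Finset V, 24 * k ≤ B.card →
      2 * ((2 * k - 1) * (B.card - k) : ℤ) < G.degSum B → G.HasDisjointCycles k B)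
    {A C : Finset V} (hn : 24 * (k + 1) ≤ A.card)
    (hE : 2 * ((2 * k + 1) * (A.card - k - 1) : ℤ) ≤ G.degSum A)
    (hno : ¬ G.HasDisjointCycles (k + 1) A) (hCA : C ⊆ A) (hC : G.HasCycleIn C)
    (hcard : C.card ≤ 4) :
    2 * ((2 * k + 1) * (A.card - k - 1) : ℤ) + G.degSum C ≤
      2 * ((2 * k - 1) * (A.card - C.card - k)) + 2 * ∑ c ∈ C, (G.degIn A c : ℤ) := by
  by_contra! hcon
  refine hno ⟨C, hCA, hC, ih _ ?_ ?_⟩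
  · rw [Finset.card_sdiff_of_subset hCA]; omega
  · have h1 := degSum_sdiff (G := G) hCA
    zify at h1
    rw [Finset.card_sdiff_of_subset hCA, Nat.cast_sub (Finset.card_le_card hCA)]
    linarith

lemma degIn_triangle {k : ℕ}
    (ih : ∀ B : Finset V, 24 * k ≤ B.card →
      2 * ((2 * k - 1) * (B.card - k) : ℤ) < G.degSum B → G.HasDisjointCycles k B)
    {A : Finset V} (hn : 24 * (k + 1) ≤ A.card)
    (hE : 2 * ((2 * k + 1) * (A.card - k - 1) : ℤ) ≤ G.degSum A)
    (hno : ¬ G.HasDisjointCycles (k + 1) A) {a b c : V} (ha : a ∈ A) (hb : b ∈ A) (hc : c ∈ A)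
    (hab : G.Adj a b) (hbc : G.Adj b c) (hca : G.Adj c a) :
    2 * A.card + 2 * k ≤ G.degIn A a + G.degIn A b + G.degIn A c + 1 := by
  have hcard : ({a, b, c} : Finset V).card = 3 :=
    Finset.card_eq_three.2 ⟨a, b, c, hab.ne, hca.ne', hbc.ne, rfl⟩
  have h := degSum_le_of_short_cycle ih hn hE hno (C := {a, b, c})
    (by simp [Finset.insert_subset_iff, ha, hb, hc]) (hasCycleIn_triangle hab hbc hca) (by omega)
  have hs : ∀ f : V → ℕ, ∑ x ∈ ({a, b, c} : Finset V), f x = f a + f b + f c := by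
    intro f
    rw [Finset.sum_insert (by simp [hab.ne, hca.ne']), Finset.sum_pair hbc.ne, add_assoc]
  have h2 : ∀ x y z : V, y ∈ ({a, b, c} : Finset V) → z ∈ ({a, b, c} : Finset V) → y ≠ z →
      G.Adj x y → G.Adj x z → 2 ≤ G.degIn {a, b, c} x := fun x y z hy hz hyz hxy hxz =>
    Finset.one_lt_card.2 ⟨y, by simp_all, z, by simp_all, hyz⟩
  have hC : 6 ≤ G.degSum {a, b, c} := by
    have h2a := h2 a b c (by simp) (by simp) hbc.ne hab hca.symm
    have h2b := h2 b a c (by simp) (by simp) hca.ne' hab.symm hbc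
    have h2c := h2 c a b (by simp) (by simp) hab.ne hca hbc.symm
    rw [degSum, hs]
    omega
  rw [← Nat.cast_sum, hs, hcard] at h
  zify at hC ⊢
  push_cast at h
  linarith

lemma degIn_square {k : ℕ}
    (ih : ∀ B : Finset V, 24 * k ≤ B.card →
      2 * ((2 * k - 1) * (B.card - k) : ℤ) < G.degSum B → G.HasDisjointCycles k B)
    {A : Finset V} (hn : 24 * (k + 1) ≤ A.card)
    (hE : 2 * ((2 * k + 1) * (A.card - k - 1) : ℤ) ≤ G.degSum A)
    (hno : ¬ G.HasDisjointCycles (k + 1) A) {a b c d : V} (ha : a ∈ A) (hb : b ∈ A) (hc : c ∈ A)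
    (hd : d ∈ A) (hac : a ≠ c) (hbd : b ≠ d)
    (hab : G.Adj a b) (hbc : G.Adj b c) (hcd : G.Adj c d) (hda : G.Adj d a) :
    2 * A.card + 4 * k ≤ G.degIn A a + G.degIn A b + G.degIn A c + G.degIn A d + 1 := by
  have hcard : ({a, b, c, d} : Finset V).card = 4 := by
    rw [Finset.card_insert_of_notMem (by simp [hab.ne, hda.ne', hac]),
      Finset.card_eq_three.2 ⟨b, c, d, hbc.ne, hbd, hcd.ne, rfl⟩]
  have h := degSum_le_of_short_cycle ih hn hE hno (C := {a, b, c, d})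
    (by simp [Finset.insert_subset_iff, ha, hb, hc, hd])
    (hasCycleIn_square hab hbc hcd hda hac hbd) (by omega)
  have hs : ∀ f : V → ℕ, ∑ x ∈ ({a, b, c, d} : Finset V), f x = f a + f b + f c + f d := by
    intro f
    rw [Finset.sum_insert (by simp [hab.ne, hda.ne', hac]),
      Finset.sum_insert (by simp [hbc.ne, hbd]), Finset.sum_pair hcd.ne]
    ring
  have h2 : ∀ x y z : V, y ∈ ({a, b, c, d} : Finset V) → z ∈ ({a, b, c, d} : Finset V) → y ≠ z →
      G.Adj x y → G.Adj x z → 2 ≤ G.degIn {a, b, c, d} x := fun x y z hy hz hyz hxy hxz =>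
    Finset.one_lt_card.2 ⟨y, by simp_all, z, by simp_all, hyz⟩
  have hC : 8 ≤ G.degSum {a, b, c, d} := by
    have h2a := h2 a b d (by simp) (by simp) hbd hab hda.symm
    have h2b := h2 b a c (by simp) (by simp) hac hab.symm hbc
    have h2c := h2 c b d (by simp) (by simp) hbd hbc.symm hcd
    have h2d := h2 d a c (by simp) (by simp) hac hda hcd.symm
    rw [degSum, hs]
    omega
  rw [← Nat.cast_sum, hs, hcard] at h
  zify at hC ⊢
  push_cast at h
  linarith


/-- Two vertices of large degree cannot both be joined to many isolated vertices. -/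
lemma false_of_two_large_degIn {k : ℕ} {A H : Finset V} {x y : V}
    (hT : ∀ a ∈ A, ∀ b ∈ A, ∀ c ∈ A, G.Adj a b → G.Adj b c → G.Adj c a →
      2 * A.card + 2 * k ≤ G.degIn A a + G.degIn A b + G.degIn A c + 1)
    (hS : ∀ a ∈ A, ∀ b ∈ A, ∀ c ∈ A, ∀ d ∈ A, a ≠ c → b ≠ d →
      G.Adj a b → G.Adj b c → G.Adj c d → G.Adj d a →
      2 * A.card + 4 * k ≤ G.degIn A a + G.degIn A b + G.degIn A c + G.degIn A d + 1)
    (hHA : H ⊆ A) (hx : x ∈ H) (hy : y ∈ H) (hxy : x ≠ y)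
    (hdx : 2 * A.card + 2 * k ≤ 3 * G.degIn A x + 1)
    (hdy : 2 * A.card + 2 * k ≤ 3 * G.degIn A y + 1)
    (hH : H.card ≤ 2 * k + 1) (hH' : H.card ≤ 2 * k ∨ G.degIn A x + 1 < A.card)
    (h3 : ∀ u ∈ A \ H, ∀ v ∈ A \ H, G.Adj x u → G.Adj x v → ¬ G.Adj u v)
    (h4 : ∀ u ∈ A \ H, ∀ v ∈ A \ H, ∀ w ∈ A \ H, u ≠ w →
      G.Adj x u → G.Adj u v → G.Adj v w → ¬ G.Adj x w) : False := by
  have hiso := le_card_isolated (y := y) h3 h4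
  have hF : (A \ H).card + H.card = A.card := Finset.card_sdiff_add_card_eq_card hHA
  have ex := degIn_sdiff (G := G) hHA x
  have ey := degIn_sdiff (G := G) hHA y
  have hlow : ∀ u ∈ ({u ∈ G.nbrsIn (A \ H) x ∩ G.nbrsIn (A \ H) y | G.degIn (A \ H) u = 0} :
      Finset V), u ∈ A ∧ G.Adj x u ∧ G.Adj y u ∧ G.degIn A u ≤ H.card := by
    intro u hu
    simp only [Finset.mem_filter, Finset.mem_inter, mem_nbrsIn, Finset.mem_sdiff] at hu
    refine ⟨hu.1.1.1.1, hu.1.1.2, hu.1.2.2, ?_⟩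
    rw [degIn_sdiff hHA u, hu.2]
    exact degIn_le_card u
  have lx := degIn_lt_card (G := G) (hHA hx)
  have ly := degIn_lt_card (G := G) (hHA hy)
  by_cases hadj : G.Adj x y
  · have lHx := degIn_lt_card (G := G) hx
    have lHy := degIn_lt_card (G := G) hy
    obtain ⟨u, hu⟩ := Finset.card_pos.1 (show 0 < ({u ∈ G.nbrsIn (A \ H) x ∩ G.nbrsIn (A \ H) y |
      G.degIn (A \ H) u = 0} : Finset V).card by omega)
    obtain ⟨huA, hxu, hyu, hdu⟩ := hlow u hu
    have := hT x (hHA hx) y (hHA hy) u huA hadj hyu hxu.symm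
    omega
  · have lHx := degIn_add_two_le hx hy hxy hadj
    have lHy := degIn_add_two_le hy hx hxy.symm (fun h => hadj h.symm)
    have lx := degIn_add_two_le (hHA hx) (hHA hy) hxy hadj
    have ly := degIn_add_two_le (hHA hy) (hHA hx) hxy.symm (fun h => hadj h.symm)
    obtain ⟨u, hu, v, hv, huv⟩ := Finset.one_lt_card.1 (show 1 <
      ({u ∈ G.nbrsIn (A \ H) x ∩ G.nbrsIn (A \ H) y |
        G.degIn (A \ H) u = 0} : Finset V).card by omega)
    obtain ⟨huA, hxu, hyu, hdu⟩ := hlow u hu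
    obtain ⟨hvA, hxv, hyv, hdv⟩ := hlow v hv
    have := hS x (hHA hx) u huA y (hHA hy) v hvA hxy huv hxu hyu.symm hyv hxv.symm
    omega

lemma not_adj_of_adj_adj {k : ℕ} {A H : Finset V} {x : V}
    (hT : ∀ a ∈ A, ∀ b ∈ A, ∀ c ∈ A, G.Adj a b → G.Adj b c → G.Adj c a →
      2 * A.card + 2 * k ≤ G.degIn A a + G.degIn A b + G.degIn A c + 1)
    (hHA : H ⊆ A) (hx : x ∈ H)
    (hH : H.card + 1 ≤ 2 * k ∨ H.card ≤ 2 * k ∧ G.degIn A x + 1 < A.card)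
    (hF3 : ∀ a ∈ A \ H, ∀ b ∈ A \ H, ∀ c ∈ A \ H, G.Adj a b → G.Adj b c → ¬ G.Adj c a) :
    ∀ u ∈ A \ H, ∀ v ∈ A \ H, G.Adj x u → G.Adj x v → ¬ G.Adj u v := by
  intro u hu v hv hxu hxv huv
  have hF : (A \ H).card + H.card = A.card := Finset.card_sdiff_add_card_eq_card hHA
  have h1 := degIn_add_degIn_le (G := G) (F := A \ H) (u := u) (v := v)
    (fun w hw huw hvw => hF3 u hu v hv w hw huv hvw huw.symm)
  have h2 := hT x (hHA hx) u (Finset.sdiff_subset hu) v (Finset.sdiff_subset hv) hxu huv hxv.symm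
  have eu := degIn_sdiff (G := G) hHA u
  have ev := degIn_sdiff (G := G) hHA v
  have lu := degIn_le_card (G := G) (A := H) u
  have lv := degIn_le_card (G := G) (A := H) v
  have lx := degIn_lt_card (G := G) (hHA hx)
  omega

lemma not_adj_of_path_three {k : ℕ} {A H : Finset V} {x : V}
    (hS : ∀ a ∈ A, ∀ b ∈ A, ∀ c ∈ A, ∀ d ∈ A, a ≠ c → b ≠ d →
      G.Adj a b → G.Adj b c → G.Adj c d → G.Adj d a →
      2 * A.card + 4 * k ≤ G.degIn A a + G.degIn A b + G.degIn A c + G.degIn A d + 1)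
    (hHA : H ⊆ A) (hx : x ∈ H)
    (hH : H.card + 1 ≤ 2 * k ∨ H.card ≤ 2 * k ∧ G.degIn A x + 1 < A.card)
    (hF3 : ∀ a ∈ A \ H, ∀ b ∈ A \ H, ∀ c ∈ A \ H, G.Adj a b → G.Adj b c → ¬ G.Adj c a)
    (hF4 : ∀ a ∈ A \ H, ∀ b ∈ A \ H, ∀ c ∈ A \ H, ∀ d ∈ A \ H, a ≠ c → b ≠ d →
      G.Adj a b → G.Adj b c → G.Adj c d → ¬ G.Adj d a)
    (h3 : ∀ u ∈ A \ H, ∀ v ∈ A \ H, G.Adj x u → G.Adj x v → ¬ G.Adj u v) :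
    ∀ u ∈ A \ H, ∀ v ∈ A \ H, ∀ w ∈ A \ H, u ≠ w →
      G.Adj x u → G.Adj u v → G.Adj v w → ¬ G.Adj x w := by
  intro u hu v hv w hw huw hxu huv hvw hxw
  have hF : (A \ H).card + H.card = A.card := Finset.card_sdiff_add_card_eq_card hHA
  have hxv : ¬ G.Adj x v := fun h => h3 u hu v hv hxu h huv
  have hne : x ≠ v := fun h => (Finset.mem_sdiff.1 hv).2 (h ▸ hx)
  have h2 := hS x (hHA hx) u (Finset.sdiff_subset hu) v (Finset.sdiff_subset hv) w
    (Finset.sdiff_subset hw) hne huw hxu huv hvw hxw.symm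
  have eu := degIn_sdiff (G := G) hHA u
  have ev := degIn_sdiff (G := G) hHA v
  have ew := degIn_sdiff (G := G) hHA w
  have lu := degIn_le_card (G := G) (A := H) u
  have lw := degIn_le_card (G := G) (A := H) w
  have lv : G.degIn H v < H.card := by
    refine Finset.card_lt_card (Finset.ssubset_iff_subset_ne.2 ⟨nbrsIn_subset, fun h => hxv ?_⟩)
    rw [← h, mem_nbrsIn] at hx
    exact hx.2.symm
  have lx := degIn_lt_card (G := G) (hHA hx)
  have hui := Finset.card_union_add_card_inter (G.nbrsIn (A \ H) u) (G.nbrsIn (A \ H) w)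
  have hi : (G.nbrsIn (A \ H) u ∩ G.nbrsIn (A \ H) w).card ≤ 1 := by
    refine (Finset.card_le_card (t := {v}) fun z hz => ?_).trans (Finset.card_singleton v).le
    rw [Finset.mem_inter, mem_nbrsIn, mem_nbrsIn] at hz
    rw [Finset.mem_singleton]
    by_contra hzv
    exact hF4 u hu v hv w hw z hz.1.1 huw (Ne.symm hzv) huv hvw hz.2.2 hz.1.2.symm
  have hd : Disjoint (G.nbrsIn (A \ H) u ∪ G.nbrsIn (A \ H) w) (G.nbrsIn (A \ H) v) := by
    rw [Finset.disjoint_left]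
    intro z hz hz'
    rw [Finset.mem_union, mem_nbrsIn, mem_nbrsIn] at hz
    rw [mem_nbrsIn] at hz'
    rcases hz with hz | hz
    · exact hF3 u hu v hv z hz.1 huv hz'.2 hz.2.symm
    · exact hF3 w hw v hv z hz.1 hvw.symm hz'.2 hz.2.symm
  have hc := Finset.card_union_of_disjoint hd
  have hle : (G.nbrsIn (A \ H) u ∪ G.nbrsIn (A \ H) w ∪ G.nbrsIn (A \ H) v).card ≤
      (A \ H).card := Finset.card_le_card
    (Finset.union_subset (Finset.union_subset nbrsIn_subset nbrsIn_subset) nbrsIn_subset)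
  unfold degIn at *
  omega

lemma degSum_add_le_of_forall_degIn {A H : Finset V} (hHA : H ⊆ A)
    (hfull : ∀ x ∈ H, A.card ≤ G.degIn A x + 1) :
    G.degSum A + H.card * (H.card - 1) ≤ G.degSum (A \ H) + 2 * (H.card * (A.card - 1)) := by
  have h1 := degSum_sdiff (G := G) hHA
  have h2 : ∑ c ∈ H, G.degIn A c ≤ H.card * (A.card - 1) := by
    rw [← smul_eq_mul]
    refine Finset.sum_le_card_nsmul _ _ _ fun x hx => ?_
    have := degIn_lt_card (G := G) (hHA hx)
    omega
  have h3 : H.card * (H.card - 1) ≤ G.degSum H := by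
    rw [← smul_eq_mul]
    refine Finset.card_nsmul_le_sum _ _ _ fun x hx => ?_
    rw [← Finset.card_erase_of_mem hx]
    refine Finset.card_le_card fun y hy => ?_
    rw [Finset.mem_erase] at hy
    exact mem_nbrsIn.2 ⟨hy.2, adj_of_card_le_degIn (hHA hx) (hHA hy.2) hy.1.symm (hfull x hx)⟩
  omega

lemma hasDisjointCycles_or_isClique {k : ℕ} (hk : 1 ≤ k)
    (ih : ∀ B : Finset V, 24 * k ≤ B.card →
      2 * ((2 * k - 1) * (B.card - k) : ℤ) < G.degSum B → G.HasDisjointCycles k B)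
    {A : Finset V} (hn : 24 * (k + 1) ≤ A.card)
    (hE : 2 * ((2 * k + 1) * (A.card - k - 1) : ℤ) ≤ G.degSum A) :
    G.HasDisjointCycles (k + 1) A ∨
      (∃ S ⊆ A, S.card = 2 * k + 1 ∧ G.IsClique (S : Set V)) ∧
        (G.degSum A : ℤ) ≤ 2 * ((2 * k + 1) * (A.card - k - 1)) := by
  by_cases hno : G.HasDisjointCycles (k + 1) A
  · exact Or.inl hno
  have hT : ∀ a ∈ A, ∀ b ∈ A, ∀ c ∈ A, G.Adj a b → G.Adj b c → G.Adj c a →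
      2 * A.card + 2 * k ≤ G.degIn A a + G.degIn A b + G.degIn A c + 1 :=
    fun a ha b hb c hc => degIn_triangle ih hn hE hno ha hb hc
  have hS : ∀ a ∈ A, ∀ b ∈ A, ∀ c ∈ A, ∀ d ∈ A, a ≠ c → b ≠ d →
      G.Adj a b → G.Adj b c → G.Adj c d → G.Adj d a →
      2 * A.card + 4 * k ≤ G.degIn A a + G.degIn A b + G.degIn A c + G.degIn A d + 1 :=
    fun a ha b hb c hc d hd => degIn_square ih hn hE hno ha hb hc hd
  set H : Finset V := {x ∈ A | 2 * A.card + 2 * k ≤ 3 * G.degIn A x + 1} with hHdef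
  have hHA : H ⊆ A := Finset.filter_subset _ _
  have hHdeg : ∀ x ∈ H, 2 * A.card + 2 * k ≤ 3 * G.degIn A x + 1 :=
    fun x hx => (Finset.mem_filter.1 hx).2
  have hFdeg : ∀ x ∈ A \ H, 3 * G.degIn A x + 1 < 2 * A.card + 2 * k := by
    intro x hx
    rw [Finset.mem_sdiff, hHdef, Finset.mem_filter, not_and, not_le] at hx
    exact hx.2 hx.1
  have hF : (A \ H).card + H.card = A.card := Finset.card_sdiff_add_card_eq_card hHA
  have hFA : A \ H ⊆ A := Finset.sdiff_subset
  have hF3 : ∀ a ∈ A \ H, ∀ b ∈ A \ H, ∀ c ∈ A \ H, G.Adj a b → G.Adj b c → ¬ G.Adj c a := by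
    intro a ha b hb c hc hab hbc hca
    have h1 := hT a (hFA ha) b (hFA hb) c (hFA hc) hab hbc hca
    have h2 := hFdeg a ha
    have h3 := hFdeg b hb
    have h4 := hFdeg c hc
    omega
  -- A short cycle outside `2 * k` vertices of `H` extends to `k + 1` disjoint cycles.
  have hshort : ∀ X ⊆ H, ∀ C ⊆ A, X.card = 2 * k → C.card ≤ 4 → Disjoint X C →
      ¬ G.HasCycleIn C := fun X hX C hC hXc hCc hXC hcyc =>
    hno ⟨C, hC, hcyc, hasDisjointCycles_of_large_degIn hk hn (hX.trans hHA) hXC hXc (by omega)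
      (by omega) fun x hx => hHdeg x (hX hx)⟩
  have hc3 : ∀ a b c : V, ({a, b, c} : Finset V).card ≤ 3 := fun a b c => Finset.card_le_three
  have hc4 : ∀ a b c d : V, ({a, b, c, d} : Finset V).card ≤ 4 := fun a b c d =>
    Finset.card_le_four
  have hpair : 2 ≤ H.card → ∀ x ∈ H, ∃ y ∈ H, x ≠ y := by
    intro h x hx
    obtain ⟨y, hy, hyx⟩ := Finset.exists_mem_ne (by omega : 1 < H.card) x
    exact ⟨y, hy, hyx.symm⟩
  rcases lt_trichotomy H.card (2 * k) with hlt | heq | hgt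
  · have hF4 : ∀ a ∈ A \ H, ∀ b ∈ A \ H, ∀ c ∈ A \ H, ∀ d ∈ A \ H, a ≠ c → b ≠ d →
        G.Adj a b → G.Adj b c → G.Adj c d → ¬ G.Adj d a := by
      intro a ha b hb c hc d hd hac hbd hab hbc hcd hda
      have h1 := hS a (hFA ha) b (hFA hb) c (hFA hc) d (hFA hd) hac hbd hab hbc hcd hda
      have h2 := degIn_add_degIn_le (G := G) (F := A \ H) (u := a) (v := b)
        fun w hw haw hbw => hF3 a ha b hb w hw hab hbw haw.symm
      have h3 := degIn_add_degIn_le (G := G) (F := A \ H) (u := c) (v := d)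
        fun w hw haw hbw => hF3 c hc d hd w hw hcd hbw haw.symm
      have hle : ∀ z, G.degIn A z ≤ H.card + G.degIn (A \ H) z := fun z => by
        rw [degIn_sdiff hHA z]
        exact Nat.add_le_add_right (degIn_le_card z) _
      have ha' := hle a
      have hb' := hle b
      have hc' := hle c
      have hd' := hle d
      omega
    rcases Nat.lt_or_ge H.card 2 with hH1 | hH2
    · refine absurd ((hasDisjointCycles_of_degSum hF3 hF4 (by omega) ?_).mono hFA) hno
      have h1 := degSum_sdiff (G := G) hHA
      have h2 : ∑ c ∈ H, G.degIn A c ≤ H.card * (A.card - 1) := by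
        rw [← smul_eq_mul]
        refine Finset.sum_le_card_nsmul _ _ _ fun x hx => ?_
        have := degIn_lt_card (G := G) (hHA hx)
        omega
      zify [(by omega : 1 ≤ A.card)] at h1 h2 hF hn hk ⊢
      have h3 : ((A \ H).card : ℤ) = A.card - H.card := by linarith
      rw [h3]
      have h4 : (0 : ℤ) ≤ G.degSum H := Int.natCast_nonneg _
      interval_cases h : H.card
      · push_cast at *
        nlinarith
      · push_cast at *
        nlinarith
    · obtain ⟨x, hx⟩ := Finset.card_pos.1 (by omega : 0 < H.card)
      obtain ⟨y, hy, hxy⟩ := hpair hH2 x hx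
      have h3 := not_adj_of_adj_adj hT hHA hx (Or.inl hlt) hF3
      have h4 := not_adj_of_path_three hS hHA hx (Or.inl hlt) hF3 hF4 h3
      exact (false_of_two_large_degIn hT hS hHA hx hy hxy (hHdeg x hx) (hHdeg y hy) (by omega)
        (Or.inl hlt.le) h3 h4).elim
  · have hF4 : ∀ a ∈ A \ H, ∀ b ∈ A \ H, ∀ c ∈ A \ H, ∀ d ∈ A \ H, a ≠ c → b ≠ d →
        G.Adj a b → G.Adj b c → G.Adj c d → ¬ G.Adj d a := by
      intro a ha b hb c hc d hd hac hbd hab hbc hcd hda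
      rw [Finset.mem_sdiff] at ha hb hc hd
      refine hshort H subset_rfl {a, b, c, d} ?_ heq (hc4 _ _ _ _) ?_
        (hasCycleIn_square hab hbc hcd hda hac hbd)
      · simp [Finset.insert_subset_iff, ha.1, hb.1, hc.1, hd.1]
      · simp [ha.2, hb.2, hc.2, hd.2]
    by_cases hex : ∃ x ∈ H, G.degIn A x + 1 < A.card
    · obtain ⟨x, hx, hdx⟩ := hex
      obtain ⟨y, hy, hxy⟩ := hpair (by omega) x hx
      have h3 := not_adj_of_adj_adj hT hHA hx (Or.inr ⟨heq.le, hdx⟩) hF3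
      have h4 := not_adj_of_path_three hS hHA hx (Or.inr ⟨heq.le, hdx⟩) hF3 hF4 h3
      exact (false_of_two_large_degIn hT hS hHA hx hy hxy (hHdeg x hx) (hHdeg y hy) (by omega)
        (Or.inl heq.le) h3 h4).elim
    push Not at hex
    have hadj : ∀ x ∈ H, ∀ u ∈ A, x ≠ u → G.Adj x u := fun x hx u hu hxu =>
      adj_of_card_le_degIn (hHA hx) hu hxu (hex x hx)
    have hadjF : ∀ x ∈ H, ∀ u ∈ A \ H, G.Adj x u := fun x hx u hu =>
      hadj x hx u (hFA hu) fun h => (Finset.mem_sdiff.1 hu).2 (h ▸ hx)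
    obtain ⟨x, hx⟩ := Finset.card_pos.1 (by omega : 0 < H.card)
    obtain ⟨y, hy, hxy⟩ := hpair (by omega) x hx
    by_cases hedge : ∀ u ∈ A \ H, ∀ v ∈ A \ H, ¬ G.Adj u v
    · exfalso
      have h1 := degSum_add_le_of_forall_degIn hHA hex
      rw [degSum_eq_zero_of_forall_not_adj hedge, heq] at h1
      zify [(by omega : 1 ≤ A.card), (by omega : 1 ≤ 2 * k)] at h1 hn
      nlinarith
    push Not at hedge
    obtain ⟨u, hu, v, hv, huv⟩ := hedge
    have h1 := hT x (hHA hx) u (hFA hu) v (hFA hv) (hadjF x hx u hu) huv (hadjF x hx v hv).symm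
    have lx := degIn_lt_card (G := G) (hHA hx)
    have eu := degIn_sdiff (G := G) hHA u
    have ev := degIn_sdiff (G := G) hHA v
    have lu := degIn_le_card (G := G) (A := H) u
    have lv := degIn_le_card (G := G) (A := H) v
    have du := hFdeg u hu
    have dv := hFdeg v hv
    obtain ⟨a, ha, hav⟩ := Finset.exists_mem_ne
      (show 1 < (G.nbrsIn (A \ H) u).card by unfold degIn at *; omega) v
    obtain ⟨b, hb, hbu⟩ := Finset.exists_mem_ne
      (show 1 < (G.nbrsIn (A \ H) v).card by unfold degIn at *; omega) u
    rw [mem_nbrsIn] at ha hb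
    have hab : a ≠ b := by
      rintro rfl
      exact hF3 u hu v hv a ha.1 huv hb.2 ha.2.symm
    have hua := ha.2.ne
    have hvb := hb.2.ne
    have huv' := huv.ne
    have hxa := hadjF x hx a ha.1
    have hyb := hadjF y hy b hb.1
    have hxu := hadjF x hx u hu
    have hyv := hadjF y hy v hv
    have haF := Finset.mem_sdiff.1 ha.1
    have hbF := Finset.mem_sdiff.1 hb.1
    have huF := Finset.mem_sdiff.1 hu
    have hvF := Finset.mem_sdiff.1 hv
    obtain ⟨m, rfl⟩ : ∃ m, k = m + 1 := ⟨k - 1, by omega⟩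
    have hlarge := hasDisjointCycles_of_large_degIn (G := G) (j := m) (X := H \ {x, y})
      (C := {x, u, a} ∪ {y, v, b}) hk hn (Finset.sdiff_subset.trans hHA) ?_ ?_ (by omega) ?_
      fun z hz => hHdeg z (Finset.sdiff_subset hz)
    · refine absurd ⟨{x, u, a}, ?_, hasCycleIn_triangle hxu ha.2 hxa.symm, {y, v, b}, ?_,
        hasCycleIn_triangle hyv hb.2 hyb.symm, ?_⟩ hno
      · simp [Finset.insert_subset_iff, hHA hx, huF.1, haF.1]
      · have := hHA hy
        intro z hz
        simp only [Finset.mem_insert, Finset.mem_singleton, Finset.mem_sdiff] at hz ⊢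
        grind
      · rwa [sdiff_sdiff_left]
    · rw [Finset.disjoint_left]
      intro z hz
      simp only [Finset.mem_insert, Finset.mem_singleton, Finset.mem_sdiff,
        Finset.mem_union] at hz ⊢
      grind
    · have h2 : ({x, y} : Finset V) ⊆ H := by simp [Finset.insert_subset_iff, hx, hy]
      rw [Finset.card_sdiff_of_subset h2, Finset.card_pair hxy]
      omega
    · have h2 := Finset.card_union_le ({x, u, a} : Finset V) {y, v, b}
      have h3 := hc3 x u a
      have h4 := hc3 y v b
      omega
  rcases Nat.lt_or_ge (2 * k + 1) H.card with hge | hle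
  · obtain ⟨X, hXH, hX⟩ := Finset.exists_subset_card_eq (by omega : 2 * (k + 1) ≤ H.card)
    have := hasDisjointCycles_of_large_degIn (C := ∅) hk hn (hXH.trans hHA)
      (Finset.disjoint_empty_right X) hX le_rfl (by simp) fun x hx => hHdeg x (hXH hx)
    rw [Finset.sdiff_empty] at this
    exact absurd this hno
  have heq : H.card = 2 * k + 1 := by omega
  have hshort' : ∀ x ∈ H, ∀ C ⊆ A \ H, C.card ≤ 3 → ¬ G.HasCycleIn (insert x C) := by
    intro x hx C hC hCc
    refine hshort (H.erase x) (Finset.erase_subset _ _) (insert x C) ?_ ?_ ?_ ?_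
    · exact Finset.insert_subset (hHA hx) (hC.trans hFA)
    · rw [Finset.card_erase_of_mem hx, heq, Nat.add_sub_cancel]
    · exact (Finset.card_insert_le _ _).trans (by omega)
    · rw [Finset.disjoint_insert_right]
      exact ⟨Finset.notMem_erase _ _,
        Finset.disjoint_sdiff.mono (Finset.erase_subset _ _) hC⟩
  have h3 : ∀ x ∈ H, ∀ u ∈ A \ H, ∀ v ∈ A \ H, G.Adj x u → G.Adj x v → ¬ G.Adj u v := by
    intro x hx u hu v hv hxu hxv huv
    exact hshort' x hx {u, v} (by simp [Finset.insert_subset_iff, hu, hv, -Finset.mem_sdiff])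
      (Finset.card_le_two.trans (by omega)) (hasCycleIn_triangle hxu huv hxv.symm)
  by_cases hex : ∃ x ∈ H, G.degIn A x + 1 < A.card
  · obtain ⟨x, hx, hdx⟩ := hex
    obtain ⟨y, hy, hxy⟩ := hpair (by omega) x hx
    refine (false_of_two_large_degIn hT hS hHA hx hy hxy (hHdeg x hx) (hHdeg y hy) hle
      (Or.inr hdx) (h3 x hx) ?_).elim
    intro u hu v hv w hw huw hxu huv hvw hxw
    refine hshort' x hx {u, v, w}
      (by simp [Finset.insert_subset_iff, hu, hv, hw, -Finset.mem_sdiff]) (hc3 _ _ _)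
      (hasCycleIn_square hxu huv hvw hxw.symm ?_ huw)
    rintro rfl
    exact (Finset.mem_sdiff.1 hv).2 hx
  push Not at hex
  have hadj : ∀ x ∈ H, ∀ u ∈ A, x ≠ u → G.Adj x u := fun x hx u hu hxu =>
    adj_of_card_le_degIn (hHA hx) hu hxu (hex x hx)
  refine Or.inr ⟨⟨H, hHA, heq, fun x hx y hy hxy => hadj x hx y (hHA hy) hxy⟩, ?_⟩
  obtain ⟨x, hx⟩ := Finset.card_pos.1 (by omega : 0 < H.card)
  have h1 := degSum_add_le_of_forall_degIn hHA hex
  rw [degSum_eq_zero_of_forall_not_adj (F := A \ H), heq] at h1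
  · zify [(by omega : 1 ≤ A.card)] at h1
    push_cast at h1
    linarith
  · intro u hu v hv
    have hne : ∀ z ∈ A \ H, x ≠ z := fun z hz h => (Finset.mem_sdiff.1 hz).2 (h ▸ hx)
    exact h3 x hx u hu v hv (hadj x hx u (hFA hu) (hne u hu)) (hadj x hx v (hFA hv) (hne v hv))

/-- A set inducing more than `(2 * k - 1) * (n - k)` edges on its `n ≥ 24 * k` vertices
contains `k` disjoint cycles. -/
theorem hasDisjointCycles_of_lt_degSum {k : ℕ} (hk : 1 ≤ k) (A : Finset V)
    (hn : 24 * k ≤ A.card) (hE : 2 * ((2 * k - 1) * (A.card - k) : ℤ) < G.degSum A) :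
    G.HasDisjointCycles k A := by
  induction k, hk using Nat.le_induction generalizing A with
  | base =>
    by_contra hno
    have hno' : ∀ T ⊆ A, ¬ G.HasCycleIn T := fun T hT hc => hno ⟨T, hT, hc, trivial⟩
    refine hno (hasDisjointCycles_of_degSum ?_ ?_ (by omega) ?_)
    · intro a ha b hb c hc hab hbc hca
      exact hno' _ (by simp [Finset.insert_subset_iff, *]) (hasCycleIn_triangle hab hbc hca)
    · intro a ha b hb c hc d hd hac hbd hab hbc hcd hda
      exact hno' _ (by simp [Finset.insert_subset_iff, *])
        (hasCycleIn_square hab hbc hcd hda hac hbd)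
    · push_cast at hE
      omega
  | succ k hk ih =>
    push_cast at hE
    rcases hasDisjointCycles_or_isClique hk ih hn (by linarith) with h | ⟨-, h⟩
    · exact h
    · exact absurd h (by rw [not_le]; linarith)

end SimpleGraph

/-- **Erdős–Pósa dichotomy with a clique** (used in Theorems 1 and 2 of the paper):
if `d > 1`, `v ≥ 24 d`, and a simple graph `G` on `v` vertices has at least
`(2d-1)·v - 2d² + d` edges, then `G` contains `d` pairwise vertex-disjoint cycles,
or a clique of size `2d - 1`. -/
theorem erdos_posa_cycles_or_clique {V : Type*} [Fintype V] [DecidableEq V]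
    (G : SimpleGraph V) [DecidableRel G.Adj] (d : ℕ) (hd : 1 < d)
    (hv : 24 * d ≤ Fintype.card V)
    (he : (2 * (d : ℤ) - 1) * (Fintype.card V : ℤ) - 2 * (d : ℤ) ^ 2 + (d : ℤ) ≤
      (G.edgeFinset.card : ℤ)) :
    (∃ (c : Fin d → V) (w : ∀ i : Fin d, G.Walk (c i) (c i)),
      (∀ i, (w i).IsCycle) ∧
      ∀ i j, i ≠ j → ∀ x, x ∈ (w i).support → x ∉ (w j).support) ∨
    (∃ S : Finset V, S.card = 2 * d - 1 ∧ G.IsClique (S : Set V)) := by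
  obtain ⟨k, rfl⟩ : ∃ k, d = k + 1 := ⟨d - 1, by omega⟩
  have hk : 1 ≤ k := by omega
  have hE : 2 * ((2 * k + 1) * ((Finset.univ : Finset V).card - k - 1) : ℤ) ≤
      G.degSum Finset.univ := by
    rw [SimpleGraph.degSum_univ, Finset.card_univ]
    push_cast at he ⊢
    linarith
  rcases SimpleGraph.hasDisjointCycles_or_isClique hk
    (SimpleGraph.hasDisjointCycles_of_lt_degSum hk) hv hE with h | ⟨⟨S, -, hS, hc⟩, -⟩
  · obtain ⟨c, w, h1, -, h2⟩ := h.exists_walks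
    exact Or.inl ⟨c, w, h1, h2⟩
  · exact Or.inr ⟨S, by omega, hc⟩
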